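/- arXiv:1412.8295 — 2 statements merged into one kernel-verified Lean document; each statement's English description precedes it below -/
import Mathlib

section
/- For every $q\in\mathbb{R}$ one has $\limsup_{n\to\infty}\tau_{\mu,n}(q)=\max\{\theta_a(q),\theta_b(q)\}$ and $\liminf_{n\to\infty}\tau_{\mu,n}(q)=\min\{\theta_a(q),\theta_b(q)\}$. -/
open MeasureTheory Metric Set Filter Topology Classical
open scoped ENNReal NNReal

noncomputable section

namespace MF

/-! ### Olsen's multifractal measures and dimension functions on a metric space -/

variable {X : Type} [MetricSpace X]

/-- The sum `∑ m(B(xᵢ,rᵢ))^q (2rᵢ)^t` associated with a countable family of centered balls. -/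
def olsenSum [MeasurableSpace X] (m : Measure X) (q t : ℝ) {ι : Type}
    (c : ι → X) (r : ι → ℝ) : ℝ≥0∞ :=
  ∑' i, m (closedBall (c i) (r i)) ^ q * ENNReal.ofReal (2 * r i) ^ t

/-- `Olsen's 𝓗^{q,t}_{m,δ}`: infimum over countable centered `δ`-coverings of `E`. -/
def Hdel [MeasurableSpace X] (m : Measure X) (q t δ : ℝ) (E : Set X) : ℝ≥0∞ :=
  ⨅ (ι : Type) (_ : Countable ι) (c : ι → X) (r : ι → ℝ)
    (_ : ∀ i, c i ∈ E) (_ : ∀ i, 0 < r i ∧ r i ≤ δ)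
    (_ : E ⊆ ⋃ i, closedBall (c i) (r i)), olsenSum m q t c r

/-- Olsen's premeasure `𝓗̄^{q,t}_m` (limit, i.e. supremum, as `δ ↓ 0`). -/
def Hpre [MeasurableSpace X] (m : Measure X) (q t : ℝ) (E : Set X) : ℝ≥0∞ :=
  ⨆ (δ : ℝ) (_ : 0 < δ), Hdel m q t δ E

/-- Olsen's multifractal Hausdorff measure `𝓗^{q,t}_m`. -/
def Hmeas [MeasurableSpace X] (m : Measure X) (q t : ℝ) (E : Set X) : ℝ≥0∞ :=
  ⨆ (F : Set X) (_ : F ⊆ E), Hpre m q t F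

/-- `𝓟̄^{q,t}_{m,δ}`: supremum over countable centered `δ`-packings of `E`. -/
def Pdel [MeasurableSpace X] (m : Measure X) (q t δ : ℝ) (E : Set X) : ℝ≥0∞ :=
  ⨆ (ι : Type) (_ : Countable ι) (c : ι → X) (r : ι → ℝ)
    (_ : ∀ i, c i ∈ E) (_ : ∀ i, 0 < r i ∧ r i ≤ δ)
    (_ : ∀ i j, i ≠ j → Disjoint (closedBall (c i) (r i)) (closedBall (c j) (r j))),
    olsenSum m q t c r

/-- Olsen's packing premeasure `𝓟̄^{q,t}_m` (limit, i.e. infimum, as `δ ↓ 0`). -/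
def Ppre [MeasurableSpace X] (m : Measure X) (q t : ℝ) (E : Set X) : ℝ≥0∞ :=
  ⨅ (δ : ℝ) (_ : 0 < δ), Pdel m q t δ E

/-- Olsen's multifractal packing measure `𝓟^{q,t}_m`. -/
def Pmeas [MeasurableSpace X] (m : Measure X) (q t : ℝ) (E : Set X) : ℝ≥0∞ :=
  ⨅ (En : ℕ → Set X) (_ : E ⊆ ⋃ n, En n), ∑' n, Ppre m q t (En n)

/-- The (topological) support of a measure on a metric space. -/
def msupport [MeasurableSpace X] (m : Measure X) : Set X :=
  {x | ∀ r : ℝ, 0 < r → 0 < m (ball x r)}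

/-- Olsen's multifractal Hausdorff dimension function `b_m`. -/
def bFun [MeasurableSpace X] (m : Measure X) (q : ℝ) : ℝ :=
  sInf {t | Hmeas m q t (msupport m) = 0}

/-- Olsen's multifractal packing dimension function `B_m`. -/
def BFun [MeasurableSpace X] (m : Measure X) (q : ℝ) : ℝ :=
  sInf {t | Pmeas m q t (msupport m) = 0}

/-- Olsen's function `τ_m`. -/
def tauFun [MeasurableSpace X] (m : Measure X) (q : ℝ) : ℝ :=
  sInf {t | Ppre m q t (msupport m) = 0}

/-- `t`-dimensional packing pre-premeasure at scale `δ`. -/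
def pPdel (t δ : ℝ) (E : Set X) : ℝ≥0∞ :=
  ⨆ (ι : Type) (_ : Countable ι) (c : ι → X) (r : ι → ℝ)
    (_ : ∀ i, c i ∈ E) (_ : ∀ i, 0 < r i ∧ r i ≤ δ)
    (_ : ∀ i j, i ≠ j → Disjoint (closedBall (c i) (r i)) (closedBall (c j) (r j))),
    ∑' i, ENNReal.ofReal (2 * r i) ^ t

/-- `t`-dimensional packing premeasure. -/
def pPpre (t : ℝ) (E : Set X) : ℝ≥0∞ := ⨅ (δ : ℝ) (_ : 0 < δ), pPdel t δ E

/-- `t`-dimensional packing measure. -/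
def pPmeas (t : ℝ) (E : Set X) : ℝ≥0∞ :=
  ⨅ (En : ℕ → Set X) (_ : E ⊆ ⋃ n, En n), ∑' n, pPpre t (En n)

/-- Packing dimension of a set. -/
def packDim (E : Set X) : ℝ := sInf {t | pPmeas t E = 0}

/-- The level set `X_m(α)` of points of the support where the local Hölder exponent is `α`. -/
def Xlev [MeasurableSpace X] (m : Measure X) (α : ℝ) : Set X :=
  {x | x ∈ msupport m ∧
    Tendsto (fun r => Real.log (m (closedBall x r)).toReal / Real.log r)
      (𝓝[>] (0 : ℝ)) (𝓝 α)}

/-- Legendre transform `f^*(x) = inf_y (xy + f(y))`. -/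
def leg (f : ℝ → ℝ) (x : ℝ) : ℝ := ⨅ y : ℝ, (x * y + f y)

/-! ### The mixed symbolic space and inhomogeneous multinomial measures -/

/-- `j` is an index governed by the first alphabet:
`T (2k-1) ≤ j < T (2k)` for some `k ≥ 1`. -/
def isA (T : ℕ → ℕ) (j : ℕ) : Prop :=
  ∃ k, 1 ≤ k ∧ T (2 * k - 1) ≤ j ∧ j < T (2 * k)

/-- The size of the alphabet at (0-based) position `n`, i.e. at paper index `j = n+1`. -/
def Yc (c₁ c₂ : ℕ) (T : ℕ → ℕ) (n : ℕ) : ℕ := if isA T (n + 1) then c₁ else c₂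

/-- The mixed symbolic space `∂𝒜₁,₂* = ∏ⱼ Yⱼ`. -/
abbrev Omg (c₁ c₂ : ℕ) (T : ℕ → ℕ) : Type := ∀ n : ℕ, Fin (Yc c₁ c₂ T n)

/-- Finite words of length `n`. -/
abbrev Word (c₁ c₂ : ℕ) (T : ℕ → ℕ) (n : ℕ) : Type :=
  ∀ i : Fin n, Fin (Yc c₁ c₂ T i.val)

/-- `N_n`: the number of indices `1 ≤ j ≤ n` governed by the first alphabet. -/
def Ncount (T : ℕ → ℕ) (n : ℕ) : ℕ := ((Finset.Icc 1 n).filter (isA T)).card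

/-- Diameter `c₁^{-N_n} c₂^{-(n-N_n)}` of a cylinder of generation `n`. -/
def Dw (c₁ c₂ : ℕ) (T : ℕ → ℕ) (n : ℕ) : ℝ :=
  ((c₁ : ℝ) ^ Ncount T n * (c₂ : ℝ) ^ (n - Ncount T n))⁻¹

/-- The cylinder `[w]` defined by a finite word `w`. -/
def cyl (c₁ c₂ : ℕ) (T : ℕ → ℕ) (n : ℕ) (w : Word c₁ c₂ T n) : Set (Omg c₁ c₂ T) :=
  {x | ∀ i : Fin n, x i.val = w i}

/-- The mass `∏_{j≤n} p_j` given to the cylinder `[w]` by the inhomogeneous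
multinomial measure with weights `a` and `b`. -/
def cylWeight (c₁ c₂ : ℕ) (T : ℕ → ℕ) (a b : ℕ → ℝ) (n : ℕ) (w : Word c₁ c₂ T n) : ℝ :=
  ∏ i : Fin n, (if isA T (i.val + 1) then a (w i).val else b (w i).val)

/-- `θ(q) = log_c (p₁^q + ⋯ + p_c^q)`. -/
def theta (c : ℕ) (p : ℕ → ℝ) (q : ℝ) : ℝ :=
  Real.logb c (∑ i ∈ Finset.range c, p i ^ q)

/-- `τ_{μ,n}(q)`, defined by `∑_{z ∈ 𝒜₁,₂ⁿ} μ([z])^q = |w|^{-τ_{μ,n}(q)}`. -/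
def tauN (c₁ c₂ : ℕ) (T : ℕ → ℕ) (a b : ℕ → ℝ) (q : ℝ) (n : ℕ) : ℝ :=
  Real.log (∑ z : Word c₁ c₂ T n, cylWeight c₁ c₂ T a b n z ^ q) /
    Real.log ((c₁ : ℝ) ^ Ncount T n * (c₂ : ℝ) ^ (n - Ncount T n))

/-- The natural projection `γ : ∂𝒜₁,₂* → [0,1]`,
`γ(ε₁ε₂⋯) = ∑_{n≥1} εₙ c₁^{-N_n} c₂^{-(n-N_n)}`. -/
def gammaMap (c₁ c₂ : ℕ) (T : ℕ → ℕ) (x : Omg c₁ c₂ T) : ℝ :=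
  ∑' n : ℕ, ((x n).val : ℝ) * Dw c₁ c₂ T (n + 1)

/-- The normalized weights `pᵢ^q / (p₁^q + ⋯ + p_c^q)`. -/
def taW (c : ℕ) (p : ℕ → ℝ) (q : ℝ) (i : ℕ) : ℝ :=
  p i ^ q / ∑ j ∈ Finset.range c, p j ^ q

/-- `s₁ = min{max aᵢ, max bⱼ}`. -/
def sOne (c₁ c₂ : ℕ) (a b : ℕ → ℝ) : ℝ :=
  min (sSup {x | ∃ i < c₁, a i = x}) (sSup {x | ∃ j < c₂, b j = x})

/-- `s₂ = max{min aᵢ, min bⱼ}`. -/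
def sTwo (c₁ c₂ : ℕ) (a b : ℕ → ℝ) : ℝ :=
  max (sInf {x | ∃ i < c₁, a i = x}) (sInf {x | ∃ j < c₂, b j = x})

/-- Entropy `h(p) = -∑_{i<2} pᵢ log₂ pᵢ`. -/
def hEnt (p : ℕ → ℝ) : ℝ := -(∑ i ∈ Finset.range 2, p i * Real.logb 2 (p i))

/-! ### Dyadic intervals -/

/-- The family `𝓕_n` of dyadic intervals of generation `n` in `[0,1]`. -/
def Fnfam (n : ℕ) : Set (Set ℝ) :=
  {I | ∃ j : ℕ, j < 2 ^ n ∧ I = Set.Icc ((j : ℝ) / 2 ^ n) (((j : ℝ) + 1) / 2 ^ n)}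

/-- Index of the dyadic interval of generation `n` containing `x`
(the left one when `x` is dyadic). -/
def dyadIdx (n : ℕ) (x : ℝ) : ℤ := ⌈x * 2 ^ n⌉ - 1

/-- `I_n(x)`: the dyadic interval of generation `n` containing `x`
(the left one when `x` is dyadic). -/
def Idyad (n : ℕ) (x : ℝ) : Set ℝ :=
  Set.Icc ((dyadIdx n x : ℝ) / 2 ^ n) (((dyadIdx n x : ℝ) + 1) / 2 ^ n)

/-- `I_n(x)⁺`: the right neighbour of `I_n(x)` in `𝓕_n`. -/
def IdyadP (n : ℕ) (x : ℝ) : Set ℝ :=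
  Set.Icc (((dyadIdx n x : ℝ) + 1) / 2 ^ n) (((dyadIdx n x : ℝ) + 2) / 2 ^ n)

/-- `I_n(x)⁻`: the left neighbour of `I_n(x)` in `𝓕_n`. -/
def IdyadM (n : ℕ) (x : ℝ) : Set ℝ :=
  Set.Icc (((dyadIdx n x : ℝ) - 1) / 2 ^ n) ((dyadIdx n x : ℝ) / 2 ^ n)

lemma limsup_eq_max_and_liminf_eq_min {u : ℕ → ℝ} {x y : ℝ} {φ ψ : ℕ → ℕ}
    (hu : ∀ᶠ n in atTop, min x y ≤ u n ∧ u n ≤ max x y)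
    (hφ : Tendsto φ atTop atTop) (hψ : Tendsto ψ atTop atTop)
    (hx : Tendsto (u ∘ φ) atTop (𝓝 x)) (hy : Tendsto (u ∘ ψ) atTop (𝓝 y)) :
    limsup u atTop = max x y ∧ liminf u atTop = min x y := by
  have hle : IsBoundedUnder (· ≤ ·) atTop u := ⟨_, eventually_map.2 (hu.mono fun _ h => h.2)⟩
  have hge : IsBoundedUnder (· ≥ ·) atTop u := ⟨_, eventually_map.2 (hu.mono fun _ h => h.1)⟩
  have hsub : ∀ {χ : ℕ → ℕ} {z : ℝ}, Tendsto χ atTop atTop → Tendsto (u ∘ χ) atTop (𝓝 z) →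
      liminf u atTop ≤ z ∧ z ≤ limsup u atTop := by
    intro χ z hχ hz
    constructor
    · refine le_of_forall_pos_le_add fun ε hε => ?_
      exact liminf_le_of_frequently_le
        (hχ.frequently ((hz.eventually (ge_mem_nhds (lt_add_of_pos_right z hε))).frequently)) hge
    · refine le_of_forall_pos_sub_le fun ε hε => ?_
      exact le_limsup_of_frequently_le
        (hχ.frequently ((hz.eventually (le_mem_nhds (sub_lt_self z hε))).frequently)) hle
  constructor
  · exact le_antisymm (limsup_le_of_le hge.isCoboundedUnder_le (hu.mono fun _ h => h.2))
      (max_le (hsub hφ hx).2 (hsub hψ hy).2)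
  · exact le_antisymm (le_min (hsub hφ hx).1 (hsub hψ hy).1)
      (le_liminf_of_le hle.isCoboundedUnder_ge (hu.mono fun _ h => h.1))

lemma Ncount_succ (T : ℕ → ℕ) (n : ℕ) :
    Ncount T (n + 1) = Ncount T n + if isA T (n + 1) then 1 else 0 := by
  unfold Ncount
  rw [← Finset.insert_Icc_right_eq_Icc_add_one (by omega), Finset.filter_insert]
  split_ifs with h
  · rw [Finset.card_insert_of_notMem (by simp)]
  · rfl

lemma Ncount_le (T : ℕ → ℕ) (n : ℕ) : Ncount T n ≤ n := by
  simpa [Ncount] using Finset.card_filter_le (Finset.Icc 1 n) (isA T)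

lemma prod_ite_isA (T : ℕ → ℕ) (x y : ℝ) (n : ℕ) :
    ∏ i ∈ Finset.range n, (if isA T (i + 1) then x else y) =
      x ^ Ncount T n * y ^ (n - Ncount T n) := by
  induction n with
  | zero => simp [Ncount]
  | succ n ih =>
    have hn := Ncount_le T n
    rw [Finset.prod_range_succ, ih, Ncount_succ]
    split_ifs
    · rw [Nat.add_sub_add_right, pow_succ]
      ring
    · rw [add_zero, Nat.sub_add_comm hn, pow_succ]
      ring

lemma sum_cylWeight_rpow {c₁ c₂ : ℕ} (T : ℕ → ℕ) {a b : ℕ → ℝ}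
    (ha : ∀ i < c₁, 0 ≤ a i) (hb : ∀ j < c₂, 0 ≤ b j) (q : ℝ) (n : ℕ) :
    ∑ z : Word c₁ c₂ T n, cylWeight c₁ c₂ T a b n z ^ q =
      (∑ i ∈ Finset.range c₁, a i ^ q) ^ Ncount T n *
        (∑ j ∈ Finset.range c₂, b j ^ q) ^ (n - Ncount T n) := by
  have hnonneg : ∀ (i : ℕ) (x : Fin (Yc c₁ c₂ T i)),
      0 ≤ if isA T (i + 1) then a x.val else b x.val := by
    intro i x
    have hx := x.isLt
    unfold Yc at hx
    split_ifs with h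
    · exact ha _ (by simpa [h] using hx)
    · exact hb _ (by simpa [h] using hx)
  have hpow : ∀ z : Word c₁ c₂ T n, cylWeight c₁ c₂ T a b n z ^ q =
      ∏ i : Fin n, (if isA T (i.val + 1) then a (z i).val else b (z i).val) ^ q := fun z =>
    (Real.finsetProd_rpow _ _ (fun i _ => hnonneg i.val (z i)) q).symm
  have hfactor : ∀ i : ℕ,
      ∑ x : Fin (Yc c₁ c₂ T i), (if isA T (i + 1) then a x.val else b x.val) ^ q =
        if isA T (i + 1) then ∑ j ∈ Finset.range c₁, a j ^ q
        else ∑ j ∈ Finset.range c₂, b j ^ q := by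
    intro i
    rw [Fin.sum_univ_eq_sum_range (fun j => (if isA T (i + 1) then a j else b j) ^ q)]
    unfold Yc
    split_ifs <;> rfl
  rw [Finset.sum_congr rfl fun z _ => hpow z, ← prod_ite_isA, Finset.prod_range,
    ← Finset.prod_congr rfl fun i _ => hfactor (i : Fin n).val, Finset.prod_univ_sum,
    Fintype.piFinset_univ]

lemma tauN_eq {c₁ c₂ : ℕ} (hc₁ : 2 ≤ c₁) (hc₂ : 2 ≤ c₂) (T : ℕ → ℕ) {a b : ℕ → ℝ}
    (ha : ∀ i < c₁, 0 < a i) (hb : ∀ j < c₂, 0 < b j) (q : ℝ) (n : ℕ) :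
    tauN c₁ c₂ T a b q n =
      (Ncount T n * (Real.log c₁ * theta c₁ a q) +
        (n - Ncount T n : ℕ) * (Real.log c₂ * theta c₂ b q)) /
      (Ncount T n * Real.log c₁ + (n - Ncount T n : ℕ) * Real.log c₂) := by
  have hpos : ∀ {c : ℕ} {p : ℕ → ℝ}, 2 ≤ c → (∀ i < c, 0 < p i) →
      0 < ∑ i ∈ Finset.range c, p i ^ q := fun hc hp =>
    Finset.sum_pos (fun i hi => Real.rpow_pos_of_pos (hp i (Finset.mem_range.1 hi)) q)
      ⟨0, Finset.mem_range.2 (by omega)⟩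
  have htheta : ∀ {c : ℕ} (p : ℕ → ℝ), 2 ≤ c →
      Real.log c * theta c p q = Real.log (∑ i ∈ Finset.range c, p i ^ q) := by
    intro c p hc
    have : Real.log c ≠ 0 := (Real.log_pos (by exact_mod_cast hc)).ne'
    rw [theta, Real.logb, mul_div_cancel₀ _ this]
  have h₁ : (c₁ : ℝ) ≠ 0 := by positivity
  have h₂ : (c₂ : ℝ) ≠ 0 := by positivity
  rw [tauN, sum_cylWeight_rpow T (fun i hi => (ha i hi).le) (fun j hj => (hb j hj).le),
    htheta a hc₁, htheta b hc₂,
    Real.log_mul (pow_ne_zero _ (hpos hc₁ ha).ne') (pow_ne_zero _ (hpos hc₂ hb).ne'),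
    Real.log_mul (pow_ne_zero _ h₁) (pow_ne_zero _ h₂)]
  simp only [Real.log_pow]

lemma weighted_average_mem {N M x y L₁ L₂ : ℝ} (hN : 0 ≤ N) (hM : 0 ≤ M) (hL₁ : 0 < L₁)
    (hL₂ : 0 < L₂) (hNM : 0 < N + M) :
    min x y ≤ (N * (L₁ * x) + M * (L₂ * y)) / (N * L₁ + M * L₂) ∧
      (N * (L₁ * x) + M * (L₂ * y)) / (N * L₁ + M * L₂) ≤ max x y := by
  have hN' : 0 ≤ N * L₁ := by positivity
  have hM' : 0 ≤ M * L₂ := by positivity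
  have hden : 0 < N * L₁ + M * L₂ := by
    rcases hN.eq_or_lt with rfl | h
    · have : 0 < M := by linarith
      positivity
    · positivity
  rw [le_div_iff₀ hden, div_le_iff₀ hden]
  constructor
  · nlinarith [mul_le_mul_of_nonneg_left (min_le_left x y) hN',
      mul_le_mul_of_nonneg_left (min_le_right x y) hM']
  · nlinarith [mul_le_mul_of_nonneg_left (le_max_left x y) hN',
      mul_le_mul_of_nonneg_left (le_max_right x y) hM']

lemma tendsto_weighted_average {N M s t : ℕ → ℝ} {L₁ : ℝ} (hL₁ : 0 < L₁) (L₂ x y : ℝ)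
    (hM : ∀ k, 0 ≤ M k) (ht : ∀ᶠ k in atTop, 0 < t k) (hMt : ∀ᶠ k in atTop, M k ≤ t k)
    (hNst : ∀ᶠ k in atTop, s k - t k ≤ N k)
    (hst : Tendsto (fun k => s k / t k) atTop atTop) :
    Tendsto (fun k => (N k * (L₁ * x) + M k * (L₂ * y)) / (N k * L₁ + M k * L₂))
      atTop (𝓝 x) := by
  have hpos : ∀ᶠ k in atTop, 0 < s k - t k := by
    filter_upwards [ht, hst.eventually_gt_atTop 1] with k h1 h2
    rw [lt_div_iff₀ h1] at h2
    linarith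
  have hratio : Tendsto (fun k => M k / N k) atTop (𝓝 0) := by
    have h0 : Tendsto (fun k => (s k / t k - 1)⁻¹) atTop (𝓝 0) :=
      (tendsto_atTop_add_const_right _ (-1) hst).inv_tendsto_atTop
    refine squeeze_zero' ?_ ?_ h0
    · filter_upwards [hpos, hNst] with k h1 h2
      exact div_nonneg (hM k) (h1.le.trans h2)
    · filter_upwards [hpos, hNst, hMt, ht] with k h1 h2 h3 h4
      have : (s k / t k - 1)⁻¹ = t k / (s k - t k) := by
        rw [div_sub_one h4.ne', inv_div]
      rw [this]
      exact div_le_div₀ h4.le h3 h1 h2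
  have hlim : Tendsto (fun k => (L₁ * x + M k / N k * (L₂ * y)) / (L₁ + M k / N k * L₂))
      atTop (𝓝 ((L₁ * x + 0 * (L₂ * y)) / (L₁ + 0 * L₂))) :=
    (tendsto_const_nhds.add (hratio.mul_const _)).div
      (tendsto_const_nhds.add (hratio.mul_const _)) (by simpa using hL₁.ne')
  have hx : (L₁ * x + 0 * (L₂ * y)) / (L₁ + 0 * L₂) = x := by
    rw [zero_mul, zero_mul, add_zero, add_zero, mul_div_cancel_left₀ _ hL₁.ne']
  rw [hx] at hlim
  refine hlim.congr' ?_
  filter_upwards [hpos, hNst] with k h1 h2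
  have hN : N k ≠ 0 := (h1.trans_le h2).ne'
  rw [← mul_div_mul_left _ _ hN]
  congr 1 <;> field_simp

lemma le_Ncount_block {T : ℕ → ℕ} {k : ℕ} (hk : 1 ≤ k) (hT : 1 ≤ T (2 * k - 1)) :
    T (2 * k) - T (2 * k - 1) ≤ Ncount T (T (2 * k) - 1) := by
  rw [← Nat.card_Ico]
  refine Finset.card_le_card fun j hj => ?_
  rw [Finset.mem_Ico] at hj
  rw [Finset.mem_filter, Finset.mem_Icc]
  exact ⟨by omega, k, hk, hj.1, hj.2⟩

lemma Ncount_block_le {T : ℕ → ℕ} (hT : StrictMonoOn T (Set.Ici 1)) {k : ℕ} (hk : 1 ≤ k) :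
    Ncount T (T (2 * k + 1) - 1) ≤ T (2 * k) - 1 := by
  have : T (2 * k) - 1 = (Finset.Icc 1 (T (2 * k) - 1)).card := by simp
  rw [this]
  refine Finset.card_le_card fun j hj => ?_
  rw [Finset.mem_filter, Finset.mem_Icc] at hj
  obtain ⟨hj, m, hm, hmj, hjm⟩ := hj
  have hlt : 2 * m - 1 < 2 * k + 1 :=
    (hT.lt_iff_lt (Set.mem_Ici.2 (by omega)) (Set.mem_Ici.2 (by omega))).1 (by omega)
  have hle : T (2 * m) ≤ T (2 * k) :=
    hT.monotoneOn (Set.mem_Ici.2 (by omega)) (Set.mem_Ici.2 (by omega)) (by omega)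
  rw [Finset.mem_Icc]
  omega

/-- `limsup τ_{μ,n}(q) = max{θ_a(q), θ_b(q)}` and
`liminf τ_{μ,n}(q) = min{θ_a(q), θ_b(q)}`. -/
theorem stmt0 (c₁ c₂ : ℕ) (hc₁ : 2 ≤ c₁) (hc₂ : 2 ≤ c₂)
    (T : ℕ → ℕ) (hT1 : T 1 = 1) (hTmono : ∀ k, 1 ≤ k → T k < T (k + 1))
    (hTrat : Tendsto (fun k => (T (k + 1) : ℝ) / (T k : ℝ)) atTop atTop)
    (a b : ℕ → ℝ) (ha : ∀ i, i < c₁ → 0 < a i ∧ a i < 1)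
    (hb : ∀ j, j < c₂ → 0 < b j ∧ b j < 1)
    (hsa : ∑ i ∈ Finset.range c₁, a i = 1) (hsb : ∑ j ∈ Finset.range c₂, b j = 1)
    (q : ℝ) :
    Filter.limsup (tauN c₁ c₂ T a b q) atTop = max (theta c₁ a q) (theta c₂ b q) ∧
    Filter.liminf (tauN c₁ c₂ T a b q) atTop = min (theta c₁ a q) (theta c₂ b q) := by
  have hL₁ : 0 < Real.log c₁ := Real.log_pos (by exact_mod_cast hc₁)
  have hL₂ : 0 < Real.log c₂ := Real.log_pos (by exact_mod_cast hc₂)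
  have hstrict : StrictMonoOn T (Set.Ici 1) := by
    have : StrictMono fun k => T (k + 1) := strictMono_nat_of_lt_succ fun k => hTmono _ (by omega)
    intro i hi j hj hij
    rw [Set.mem_Ici] at hi hj
    have h := this (show i - 1 < j - 1 by omega)
    simpa only [Nat.sub_add_cancel hi, Nat.sub_add_cancel hj] using h
  have hTge : ∀ k, 1 ≤ k → k ≤ T k := by
    intro k hk
    induction k, hk using Nat.le_induction with
    | base => omega
    | succ k hk ih => exact ih.trans_lt (hTmono k hk)
  have htau := tauN_eq hc₁ hc₂ T (fun i hi => (ha i hi).1) (fun j hj => (hb j hj).1) q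
  have htau_comm := fun n => (htau n).trans (congrArg₂ (· / ·) (add_comm _ _) (add_comm _ _))
  have hodd : Tendsto (fun k : ℕ => 2 * (k + 1) - 1) atTop atTop :=
    tendsto_atTop_mono (fun k => by rw [id_eq]; omega) tendsto_id
  have heven : Tendsto (fun k : ℕ => 2 * (k + 1)) atTop atTop :=
    tendsto_atTop_mono (fun k => by rw [id_eq]; omega) tendsto_id
  refine limsup_eq_max_and_liminf_eq_min
    (φ := fun k => T (2 * (k + 1)) - 1) (ψ := fun k => T (2 * (k + 1) + 1) - 1) ?_ ?_ ?_ ?_ ?_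
  · filter_upwards [eventually_ge_atTop 1] with n hn
    rw [htau]
    refine weighted_average_mem (Nat.cast_nonneg _) (Nat.cast_nonneg _) hL₁ hL₂ ?_
    have := Ncount_le T n
    exact_mod_cast (show 0 < Ncount T n + (n - Ncount T n) by omega)
  · exact tendsto_atTop_mono
      (fun k => by have := hTge (2 * (k + 1)) (by omega); simp only [id]; omega) tendsto_id
  · exact tendsto_atTop_mono
      (fun k => by have := hTge (2 * (k + 1) + 1) (by omega); simp only [id]; omega) tendsto_id
  · refine (tendsto_weighted_average (s := fun k => T (2 * (k + 1)))
      (t := fun k => T (2 * (k + 1) - 1)) hL₁ _ _ _ (fun k => Nat.cast_nonneg _)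
      ?_ ?_ ?_ (hTrat.comp hodd)).congr fun k => (htau _).symm <;>
    refine Eventually.of_forall fun k => ?_ <;>
    have h₁ := hTge (2 * (k + 1) - 1) (by omega) <;>
    have h₂ := le_Ncount_block (T := T) (k := k + 1) (by omega) (by omega) <;>
    have h₃ := hTmono (2 * (k + 1) - 1) (by omega) <;>
    rw [Nat.sub_add_cancel (by omega)] at h₃
    · exact_mod_cast (show 0 < T (2 * (k + 1) - 1) by omega)
    · exact_mod_cast (by omega)
    · rw [sub_le_iff_le_add]
      exact_mod_cast (by omega)
  · refine (tendsto_weighted_average (s := fun k => T (2 * (k + 1) + 1))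
      (t := fun k => T (2 * (k + 1))) hL₂ _ _ _ (fun k => Nat.cast_nonneg _)
      ?_ ?_ ?_ (hTrat.comp heven)).congr fun k => (htau_comm _).symm
    all_goals
      refine Eventually.of_forall fun k => ?_
      have h₁ := hTge (2 * (k + 1)) (by omega)
      have h₂ := Ncount_block_le hstrict (k := k + 1) (by omega)
      have h₃ := hTmono (2 * (k + 1)) (by omega)
    · exact_mod_cast (show 0 < T (2 * (k + 1)) by omega)
    · exact_mod_cast (by omega)
    · rw [sub_le_iff_le_add]
      exact_mod_cast (by omega)

end MF
end
end

section
/- Suppose $c_1=c_2=2$. Let $\varpi$ be an atomless Borel probability measure on $[0,1]$ for which there is a constant $C_1\in(0,1)$ such that $\varpi(I)\le C_1\varpi(J)$ whenever $J\in\mathscr{F}_n$ and $I\in\mathscr{F}_{n+1}$ with $I\subseteq J$. Then there is a constant $C_0>1$ such that for $\varpi$-almost every $x\in[0,1]$, for all sufficiently large $n$, $C_0^{-(\sqrt n+1)}\le\nu(I_n(x))/\nu(I_n(x)^+)\le C_0^{\sqrt n+1}$ and $C_0^{-(\sqrt n+1)}\le\nu(I_n(x))/\nu(I_n(x)^-)\le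 C_0^{\sqrt n+1}$. -/
open MeasureTheory Metric Set Filter Topology Classical
open scoped ENNReal NNReal

noncomputable section

namespace MF

/-! ### Olsen's multifractal measures and dimension functions on a metric space -/

variable {X : Type} [MetricSpace X]

/-! ### Dyadic weights -/

/-- The closed dyadic interval of generation `n` with index `j`. -/
def dyadicIcc (n j : ℕ) : Set ℝ := Set.Icc ((j : ℝ) / 2 ^ n) (((j : ℝ) + 1) / 2 ^ n)

/-- The product of the weights `p i e` along the `n` binary digits of `j`, most significant
digit first. -/
def dyadicWeight (p : ℕ → ℕ → ℝ) : ℕ → ℕ → ℝ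
  | 0, _ => 1
  | n + 1, j => dyadicWeight p n (j / 2) * p n (j % 2)

/-- The integer whose binary digits, most significant first, are `ε 0, …, ε (n - 1)`. -/
def prefixIndex (ε : ℕ → ℕ) : ℕ → ℕ
  | 0 => 0
  | n + 1 => 2 * prefixIndex ε n + ε n

/-- The weight of the letter `e` at (0-based) position `n`. -/
def letterWeight (T : ℕ → ℕ) (a b : ℕ → ℝ) (n e : ℕ) : ℝ := if isA T (n + 1) then a e else b e

lemma dyadicWeight_nonneg {p : ℕ → ℕ → ℝ} (hp : ∀ n e, e < 2 → 0 ≤ p n e) (n j : ℕ) :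
    0 ≤ dyadicWeight p n j := by
  induction n generalizing j with
  | zero => simp [dyadicWeight]
  | succ n ih => exact mul_nonneg (ih _) (hp _ _ (Nat.mod_lt _ two_pos))

lemma dyadicWeight_le_pow {p : ℕ → ℕ → ℝ} {r : ℝ} (hp : ∀ n e, e < 2 → 0 ≤ p n e)
    (hr : ∀ n e, e < 2 → p n e ≤ r) (n j : ℕ) : dyadicWeight p n j ≤ r ^ n := by
  induction n generalizing j with
  | zero => simp [dyadicWeight]
  | succ n ih =>
    have h2 : j % 2 < 2 := Nat.mod_lt _ two_pos
    rw [pow_succ]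
    exact mul_le_mul (ih _) (hr _ _ h2) (hp _ _ h2)
      ((dyadicWeight_nonneg hp n 0).trans (ih 0))

/-- If `j` ends with fewer than `k` ones, the weights of `j` and `j + 1` differ by a factor at
most `K ^ k`. -/
lemma dyadicWeight_succ_comparable {p : ℕ → ℕ → ℝ} {K : ℝ} (hK : 1 ≤ K)
    (hp : ∀ n e, e < 2 → 0 ≤ p n e)
    (hpK : ∀ n e e', e < 2 → e' < 2 → p n e ≤ K * p n e') (k n j : ℕ)
    (hj : j % 2 ^ k ≠ 2 ^ k - 1) :
    dyadicWeight p n j ≤ K ^ k * dyadicWeight p n (j + 1) ∧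
      dyadicWeight p n (j + 1) ≤ K ^ k * dyadicWeight p n j := by
  induction k generalizing n j with
  | zero => simp [Nat.mod_one] at hj
  | succ k ih =>
    have hK1 : 1 ≤ K ^ (k + 1) := one_le_pow₀ hK
    cases n with
    | zero => simpa [dyadicWeight] using hK1
    | succ n =>
      have hKk : K ≤ K ^ (k + 1) := le_self_pow₀ hK (by omega)
      have step : ∀ {u v s t : ℝ}, 0 ≤ s → 0 ≤ v → u ≤ K ^ k * v → s ≤ K * t →
          u * s ≤ K ^ (k + 1) * (v * t) := by
        intro u v s t hs hv h1 h2
        calc u * s ≤ (K ^ k * v) * (K * t) := mul_le_mul h1 h2 hs (by positivity)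
          _ = K ^ (k + 1) * (v * t) := by ring
      have hw := fun i => dyadicWeight_nonneg hp n i
      have hKk1 : 1 ≤ K ^ k := one_le_pow₀ hK
      simp only [dyadicWeight]
      have m1 : j % 2 < 2 := Nat.mod_lt _ two_pos
      have m2 : (j + 1) % 2 < 2 := Nat.mod_lt _ two_pos
      rcases Nat.even_or_odd' j with ⟨i, rfl | rfl⟩
      · have e : (2 * i + 1) / 2 = 2 * i / 2 := by omega
        rw [e]
        exact ⟨step (hp _ _ m1) (hw _) (le_mul_of_one_le_left (hw _) hKk1) (hpK _ _ _ m1 m2),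
          step (hp _ _ m2) (hw _) (le_mul_of_one_le_left (hw _) hKk1) (hpK _ _ _ m2 m1)⟩
      · have e1 : (2 * i + 1) / 2 = i := by omega
        have e2 : (2 * i + 1 + 1) / 2 = i + 1 := by omega
        rw [e1, e2]
        have hi : i % 2 ^ k ≠ 2 ^ k - 1 := by
          intro h
          apply hj
          have hpos : 0 < 2 ^ k := by positivity
          have hm : (2 * i + 1) % (2 * 2 ^ k) = 2 * (i % 2 ^ k) + 1 := by
            rw [Nat.mod_mul, e1]
            omega
          rw [pow_succ', hm, h]
          omega
        obtain ⟨h1, h2⟩ := ih n i hi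
        exact ⟨step (hp _ _ m1) (hw _) h1 (hpK _ _ _ m1 m2),
          step (hp _ _ m2) (hw _) h2 (hpK _ _ _ m2 m1)⟩

lemma prefixIndex_lt {ε : ℕ → ℕ} (hε : ∀ i, ε i < 2) (n : ℕ) : prefixIndex ε n < 2 ^ n := by
  induction n with
  | zero => simp [prefixIndex]
  | succ n ih =>
    have := hε n
    simp only [prefixIndex, pow_succ]
    omega

lemma prefixIndex_eq_iff {ε ε' : ℕ → ℕ} (hε : ∀ i, ε i < 2) (hε' : ∀ i, ε' i < 2) (n : ℕ) :
    prefixIndex ε n = prefixIndex ε' n ↔ ∀ i < n, ε i = ε' i := by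
  induction n with
  | zero => simp [prefixIndex]
  | succ n ih =>
    have h1 := hε n
    have h2 := hε' n
    rw [Nat.forall_lt_succ_right, ← ih]
    simp only [prefixIndex]
    omega

lemma prefixIndex_digits {n j m : ℕ} (hj : j < 2 ^ n) (hm : m ≤ n) :
    prefixIndex (fun i => j / 2 ^ (n - 1 - i) % 2) m = j / 2 ^ (n - m) := by
  induction m with
  | zero => simp [prefixIndex, Nat.div_eq_of_lt hj]
  | succ m ih =>
    have e1 : n - m = n - (m + 1) + 1 := by omega
    have e2 : n - 1 - m = n - (m + 1) := by omega
    rw [prefixIndex, ih (by omega), e1, e2, pow_succ, ← Nat.div_div_eq_div_mul]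
    omega

/-! ### The image measure on dyadic intervals -/

lemma Yc_two (T : ℕ → ℕ) (n : ℕ) : Yc 2 2 T n = 2 := ite_self _

lemma val_lt_two {T : ℕ → ℕ} (x : Omg 2 2 T) (n : ℕ) : (x n).val < 2 :=
  (x n).isLt.trans_eq (Yc_two T n)

lemma Dw_two (T : ℕ → ℕ) (n : ℕ) : Dw 2 2 T n = ((2 : ℝ) ^ n)⁻¹ := by
  have h : Ncount T n ≤ n := (Finset.card_filter_le _ _).trans (by simp)
  simp [Dw, ← pow_add, Nat.add_sub_cancel' h]

lemma gammaMap_two (T : ℕ → ℕ) (x : Omg 2 2 T) :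
    gammaMap 2 2 T x = Real.ofDigits (fun n => Fin.cast (Yc_two T n) (x n)) := by
  simp [gammaMap, Real.ofDigits, Real.ofDigitsTerm, Dw_two]

lemma measurable_gammaMap_two (T : ℕ → ℕ) : Measurable (gammaMap 2 2 T) := by
  rw [funext (gammaMap_two T)]
  exact Real.continuous_ofDigits.measurable.comp
    (measurable_pi_lambda _ fun n =>
      (Measurable.of_discrete (f := Fin.cast (Yc_two T n))).comp (measurable_pi_apply n))

lemma sum_ofDigitsTerm_eq_prefixIndex (d : ℕ → Fin 2) (n : ℕ) :
    ∑ i ∈ Finset.range n, Real.ofDigitsTerm d i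
      = (prefixIndex (fun i => (d i).val) n : ℝ) / 2 ^ n := by
  induction n with
  | zero => simp [prefixIndex]
  | succ n ih =>
    rw [Finset.sum_range_succ, ih, prefixIndex, Real.ofDigitsTerm]
    push_cast
    field_simp
    ring

lemma gammaMap_mem_dyadicIcc {T : ℕ → ℕ} (x : Omg 2 2 T) (n : ℕ) :
    gammaMap 2 2 T x ∈ dyadicIcc n (prefixIndex (fun i => (x i).val) n) := by
  rw [gammaMap_two, Real.ofDigits_eq_sum_add_ofDigits _ n, sum_ofDigitsTerm_eq_prefixIndex,
    dyadicIcc, add_div, one_div]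
  have h0 := Real.ofDigits_nonneg (fun i => Fin.cast (Yc_two T (i + n)) (x (i + n)))
  have h1 := Real.ofDigits_le_one (fun i => Fin.cast (Yc_two T (i + n)) (x (i + n)))
  have h2 : (0 : ℝ) ≤ (2 ^ n)⁻¹ := by positivity
  refine ⟨le_add_of_nonneg_right (mul_nonneg h2 h0), ?_⟩
  exact add_le_add_right (mul_le_of_le_one_right h2 h1) _

lemma cylWeight_two {T : ℕ → ℕ} (a b : ℕ → ℝ) (x : Omg 2 2 T) (n : ℕ) :
    cylWeight 2 2 T a b n (fun i => x i)
      = dyadicWeight (letterWeight T a b) n (prefixIndex (fun i => (x i).val) n) := by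
  induction n with
  | zero => simp [cylWeight, dyadicWeight]
  | succ n ih =>
    have h := val_lt_two x n
    have e1 : (2 * prefixIndex (fun i => (x i).val) n + (x n).val) / 2
        = prefixIndex (fun i => (x i).val) n := by omega
    have e2 : (2 * prefixIndex (fun i => (x i).val) n + (x n).val) % 2 = (x n).val := by omega
    rw [dyadicWeight, prefixIndex, e1, e2, ← ih, cylWeight, Fin.prod_univ_castSucc]
    rfl

section ImageMeasure

variable {T : ℕ → ℕ} {a b : ℕ → ℝ} {μ : Measure (Omg 2 2 T)}

lemma measure_prefixIndex_eq
    (hμ : ∀ (n : ℕ) (w : Word 2 2 T n),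
      μ (cyl 2 2 T n w) = ENNReal.ofReal (cylWeight 2 2 T a b n w))
    {n j : ℕ} (hj : j < 2 ^ n) :
    μ {x | prefixIndex (fun i => (x i).val) n = j}
      = ENNReal.ofReal (dyadicWeight (letterWeight T a b) n j) := by
  let y : Omg 2 2 T := fun i =>
    ⟨j / 2 ^ (n - 1 - i) % 2, (Nat.mod_lt _ two_pos).trans_eq (Yc_two T i).symm⟩
  have hy : prefixIndex (fun i => (y i).val) n = j := by
    simpa using prefixIndex_digits hj le_rfl
  have hset : {x : Omg 2 2 T | prefixIndex (fun i => (x i).val) n = j}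
      = cyl 2 2 T n (fun i => y i) := by
    ext x
    rw [mem_ofPred_eq, ← hy, prefixIndex_eq_iff (val_lt_two x) (val_lt_two y)]
    simp only [cyl, mem_ofPred_eq, Fin.ext_iff]
    exact ⟨fun h i => h i i.isLt, fun h i hi => h ⟨i, hi⟩⟩
  rw [hset, hμ, cylWeight_two, hy]

lemma map_gammaMap_singleton
    (hμ : ∀ (n : ℕ) (w : Word 2 2 T n),
      μ (cyl 2 2 T n w) = ENNReal.ofReal (cylWeight 2 2 T a b n w))
    (hp : ∀ n e, e < 2 → 0 ≤ letterWeight T a b n e) {r : ℝ} (hr1 : r < 1)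
    (hr : ∀ n e, e < 2 → letterWeight T a b n e ≤ r) (y : ℝ) :
    μ.map (gammaMap 2 2 T) {y} = 0 := by
  have hr0 : 0 ≤ r := (hp 0 0 two_pos).trans (hr 0 0 two_pos)
  have hle : ∀ n j, μ {x | prefixIndex (fun i => (x i).val) n = j} ≤ ENNReal.ofReal r ^ n := by
    intro n j
    by_cases hj : j < 2 ^ n
    · rw [measure_prefixIndex_eq hμ hj, ← ENNReal.ofReal_pow hr0]
      exact ENNReal.ofReal_le_ofReal (dyadicWeight_le_pow hp hr n j)
    · have : {x : Omg 2 2 T | prefixIndex (fun i => (x i).val) n = j} = ∅ :=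
        eq_empty_of_forall_notMem fun x hx => hj (hx ▸ prefixIndex_lt (val_lt_two x) n)
      simp [this]
  rw [Measure.map_apply (measurable_gammaMap_two T) (measurableSet_singleton y)]
  have hb : ∀ n : ℕ, μ (gammaMap 2 2 T ⁻¹' {y}) ≤ 2 * ENNReal.ofReal r ^ n := by
    intro n
    have hsub : gammaMap 2 2 T ⁻¹' {y} ⊆
        {x | prefixIndex (fun i => (x i).val) n = ⌊y * 2 ^ n⌋₊} ∪
          {x | prefixIndex (fun i => (x i).val) n = ⌊y * 2 ^ n⌋₊ - 1} := by
      intro x hx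
      have hm := gammaMap_mem_dyadicIcc x n
      rw [mem_preimage, mem_singleton_iff] at hx
      rw [hx, dyadicIcc, mem_Icc, div_le_iff₀ (by positivity), le_div_iff₀ (by positivity)] at hm
      have h1 := Nat.le_floor hm.1
      have h2 : ⌊y * 2 ^ n⌋₊ ≤ prefixIndex (fun i => (x i).val) n + 1 :=
        Nat.floor_le_of_le (by exact_mod_cast hm.2)
      simp only [mem_union, mem_ofPred_eq]
      omega
    calc μ (gammaMap 2 2 T ⁻¹' {y}) ≤ _ := measure_mono hsub
      _ ≤ _ := measure_union_le _ _
      _ ≤ _ := add_le_add (hle _ _) (hle _ _)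
      _ = _ := (two_mul _).symm
  have ht : Tendsto (fun n : ℕ => 2 * ENNReal.ofReal r ^ n) atTop (𝓝 (2 * 0)) :=
    ENNReal.Tendsto.const_mul
      (ENNReal.tendsto_pow_atTop_nhds_zero_of_lt_one (by simpa using hr1)) (by simp)
  rw [mul_zero] at ht
  exact le_antisymm (ge_of_tendsto' ht hb) zero_le

lemma map_gammaMap_dyadicIcc
    (hμ : ∀ (n : ℕ) (w : Word 2 2 T n),
      μ (cyl 2 2 T n w) = ENNReal.ofReal (cylWeight 2 2 T a b n w))
    (hp : ∀ n e, e < 2 → 0 ≤ letterWeight T a b n e) {r : ℝ} (hr1 : r < 1)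
    (hr : ∀ n e, e < 2 → letterWeight T a b n e ≤ r) {n j : ℕ} (hj : j < 2 ^ n) :
    μ.map (gammaMap 2 2 T) (dyadicIcc n j)
      = ENNReal.ofReal (dyadicWeight (letterWeight T a b) n j) := by
  have hm := measurable_gammaMap_two T
  have hz := map_gammaMap_singleton hμ hp hr1 hr
  rw [← measure_prefixIndex_eq hμ hj, Measure.map_apply (s := dyadicIcc n j) hm
    measurableSet_Icc]
  apply le_antisymm
  · have hsub : gammaMap 2 2 T ⁻¹' dyadicIcc n j ⊆
        {x | prefixIndex (fun i => (x i).val) n = j} ∪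
          (gammaMap 2 2 T ⁻¹' {(j : ℝ) / 2 ^ n} ∪
            gammaMap 2 2 T ⁻¹' {((j : ℝ) + 1) / 2 ^ n}) := by
      intro x hx
      have hxm := gammaMap_mem_dyadicIcc x n
      rcases lt_trichotomy (prefixIndex (fun i => (x i).val) n) j with h | h | h
      · right; left
        refine le_antisymm (hxm.2.trans ?_) hx.1
        gcongr
        exact_mod_cast h
      · exact Or.inl h
      · right; right
        refine le_antisymm hx.2 (le_trans ?_ hxm.1)
        gcongr
        exact_mod_cast h
    refine (measure_mono hsub).trans ((measure_union_le _ _).trans ?_)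
    have h0 : μ (gammaMap 2 2 T ⁻¹' {(j : ℝ) / 2 ^ n} ∪
        gammaMap 2 2 T ⁻¹' {((j : ℝ) + 1) / 2 ^ n}) = 0 := by
      rw [measure_union_null_iff, ← Measure.map_apply hm (measurableSet_singleton _),
        ← Measure.map_apply hm (measurableSet_singleton _)]
      exact ⟨hz _, hz _⟩
    rw [h0, add_zero]
  · refine measure_mono fun x hx => ?_
    have h := gammaMap_mem_dyadicIcc x n
    rw [mem_ofPred_eq] at hx
    rwa [hx] at h

end ImageMeasure

/-! ### Points whose dyadic address ends with a long constant run -/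

/-- The union of the dyadic intervals of generation `n` whose index ends with at least `⌊√n⌋`
zeros or at least `⌊√n⌋` ones. -/
def longRun (n : ℕ) : Set ℝ :=
  ⋃ i ∈ Finset.range (2 ^ (n - Nat.sqrt n)),
    dyadicIcc n (2 ^ Nat.sqrt n * i) ∪ dyadicIcc n (2 ^ Nat.sqrt n * i + (2 ^ Nat.sqrt n - 1))

lemma dyadicIcc_mem_Fnfam {n j : ℕ} (hj : j < 2 ^ n) : dyadicIcc n j ∈ Fnfam n := ⟨j, hj, rfl⟩

lemma dyadicIcc_succ_subset (n j : ℕ) : dyadicIcc (n + 1) j ⊆ dyadicIcc n (j / 2) := by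
  have h1 : ((2 * (j / 2) : ℕ) : ℝ) ≤ j := by exact_mod_cast Nat.mul_div_le j 2
  have h2 : (j : ℝ) + 1 ≤ ((2 * (j / 2) + 2 : ℕ) : ℝ) := by
    exact_mod_cast (by omega : j + 1 ≤ 2 * (j / 2) + 2)
  push_cast at h1 h2
  apply Icc_subset_Icc
  · rw [div_le_div_iff₀ (by positivity) (by positivity), pow_succ]
    nlinarith [pow_pos (two_pos : (0 : ℝ) < 2) n]
  · rw [div_le_div_iff₀ (by positivity) (by positivity), pow_succ]
    nlinarith [pow_pos (two_pos : (0 : ℝ) < 2) n]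

section Doubling

variable {ϖ : Measure ℝ} {C₁ : ℝ}

lemma measure_dyadicIcc_add_le
    (hdbl : ∀ (n : ℕ), ∀ J ∈ Fnfam n, ∀ I ∈ Fnfam (n + 1), I ⊆ J →
      ϖ I ≤ ENNReal.ofReal C₁ * ϖ J)
    (m k : ℕ) {j : ℕ} (hj : j < 2 ^ (m + k)) :
    ϖ (dyadicIcc (m + k) j) ≤ ENNReal.ofReal C₁ ^ k * ϖ (dyadicIcc m (j / 2 ^ k)) := by
  induction k generalizing j with
  | zero => simp
  | succ k ih =>
    have hj2 : j / 2 < 2 ^ (m + k) := by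
      rw [← add_assoc, pow_succ] at hj
      omega
    calc ϖ (dyadicIcc (m + (k + 1)) j)
        ≤ ENNReal.ofReal C₁ * ϖ (dyadicIcc (m + k) (j / 2)) :=
          hdbl _ _ (dyadicIcc_mem_Fnfam hj2) _ (dyadicIcc_mem_Fnfam hj)
            (dyadicIcc_succ_subset _ _)
      _ ≤ ENNReal.ofReal C₁ * (ENNReal.ofReal C₁ ^ k * ϖ (dyadicIcc m (j / 2 / 2 ^ k))) := by
          gcongr
          exact ih hj2
      _ = _ := by rw [Nat.div_div_eq_div_mul, ← pow_succ', ← mul_assoc, ← pow_succ']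

lemma sum_measure_dyadicIcc_le_one [IsProbabilityMeasure ϖ] (hϖc : ∀ x : ℝ, ϖ {x} = 0)
    (m : ℕ) (s : Finset ℕ) : ∑ i ∈ s, ϖ (dyadicIcc m i) ≤ 1 := by
  have : NullSingletonClass ϖ := ⟨hϖc⟩
  have hd : Set.PairwiseDisjoint (s : Set ℕ)
      (fun i : ℕ => Ioc ((i : ℝ) / 2 ^ m) (((i : ℝ) + 1) / 2 ^ m)) := by
    intro i _ j _ hij
    refine Set.disjoint_left.2 fun x hi hj => hij ?_
    have h1 := hi.1.trans_le hj.2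
    have h2 := hj.1.trans_le hi.2
    rw [div_lt_div_iff_of_pos_right (by positivity)] at h1 h2
    have h1' : i < j + 1 := by exact_mod_cast h1
    have h2' : j < i + 1 := by exact_mod_cast h2
    omega
  calc ∑ i ∈ s, ϖ (dyadicIcc m i)
      = ∑ i ∈ s, ϖ (Ioc ((i : ℝ) / 2 ^ m) (((i : ℝ) + 1) / 2 ^ m)) :=
        Finset.sum_congr rfl fun i _ => measure_congr Ioc_ae_eq_Icc.symm
    _ = ϖ (⋃ i ∈ s, Ioc ((i : ℝ) / 2 ^ m) (((i : ℝ) + 1) / 2 ^ m)) :=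
        (measure_biUnion_finset hd fun _ _ => measurableSet_Ioc).symm
    _ ≤ 1 := prob_le_one

lemma measure_longRun_le [IsProbabilityMeasure ϖ] (hϖc : ∀ x : ℝ, ϖ {x} = 0)
    (hdbl : ∀ (n : ℕ), ∀ J ∈ Fnfam n, ∀ I ∈ Fnfam (n + 1), I ⊆ J →
      ϖ I ≤ ENNReal.ofReal C₁ * ϖ J) (n : ℕ) :
    ϖ (longRun n) ≤ 2 * ENNReal.ofReal C₁ ^ Nat.sqrt n := by
  have hkn : Nat.sqrt n ≤ n := Nat.sqrt_le_self n
  rw [longRun]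
  generalize Nat.sqrt n = k at *
  obtain ⟨m, rfl⟩ : ∃ m, n = m + k := ⟨n - k, by omega⟩
  have hpos : 0 < 2 ^ k := by positivity
  have hblock : ∀ i ∈ Finset.range (2 ^ m), ∀ e < 2 ^ k,
      ϖ (dyadicIcc (m + k) (2 ^ k * i + e)) ≤ ENNReal.ofReal C₁ ^ k * ϖ (dyadicIcc m i) := by
    intro i hi e he
    have hlt : 2 ^ k * i + e < 2 ^ (m + k) := by
      rw [pow_add]
      nlinarith [Finset.mem_range.1 hi]
    have hdiv : (2 ^ k * i + e) / 2 ^ k = i := by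
      rw [Nat.mul_add_div hpos, Nat.div_eq_of_lt he, add_zero]
    have h := measure_dyadicIcc_add_le hdbl m k hlt
    rwa [hdiv] at h
  rw [Nat.add_sub_cancel]
  calc _ ≤ ∑ i ∈ Finset.range (2 ^ m), ϖ (dyadicIcc (m + k) (2 ^ k * i) ∪
          dyadicIcc (m + k) (2 ^ k * i + (2 ^ k - 1))) := measure_biUnion_finset_le _ _
    _ ≤ ∑ i ∈ Finset.range (2 ^ m), 2 * ENNReal.ofReal C₁ ^ k * ϖ (dyadicIcc m i) := by
        refine Finset.sum_le_sum fun i hi => (measure_union_le _ _).trans ?_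
        rw [mul_assoc, two_mul]
        exact add_le_add (hblock i hi 0 hpos) (hblock i hi _ (Nat.sub_lt hpos one_pos))
    _ = 2 * ENNReal.ofReal C₁ ^ k * ∑ i ∈ Finset.range (2 ^ m), ϖ (dyadicIcc m i) :=
        (Finset.mul_sum _ _ _).symm
    _ ≤ 2 * ENNReal.ofReal C₁ ^ k :=
        mul_le_of_le_one_right' (sum_measure_dyadicIcc_le_one hϖc m _)

end Doubling

lemma summable_pow_sqrt {r : ℝ} (hr0 : 0 ≤ r) (hr1 : r < 1) :
    Summable fun n : ℕ => r ^ Nat.sqrt n := by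
  have ht := tendsto_pow_const_mul_const_pow_of_abs_lt_one 4 (abs_lt.2 ⟨by linarith, hr1⟩)
  have ht' := (tendsto_add_atTop_iff_nat 1).2 ht
  obtain ⟨B, hB⟩ := ht'.bddAbove_range
  have hB' : ∀ k : ℕ, ((k + 1 : ℕ) : ℝ) ^ 4 * r ^ (k + 1) ≤ B := fun k => hB ⟨k, rfl⟩
  rcases hr0.eq_or_lt with rfl | hrpos
  · refine summable_of_ne_finset_zero (s := {0}) fun n hn => ?_
    rw [Finset.mem_singleton] at hn
    exact zero_pow (by rw [Ne, Nat.sqrt_eq_zero]; exact hn)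
  have hs : Summable fun n : ℕ => B / r * (1 / ((n + 1 : ℕ) : ℝ) ^ 2) :=
    ((summable_nat_add_iff 1).2 (Real.summable_one_div_nat_pow.2 one_lt_two)).mul_left _
  refine hs.of_nonneg_of_le (fun n => by positivity) fun n => ?_
  have hle : ((n + 1 : ℕ) : ℝ) ≤ ((Nat.sqrt n + 1 : ℕ) : ℝ) ^ 2 := by
    rw [sq]
    exact_mod_cast Nat.lt_succ_sqrt n
  have h4 : ((n + 1 : ℕ) : ℝ) ^ 2 ≤ ((Nat.sqrt n + 1 : ℕ) : ℝ) ^ 4 := by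
    calc ((n + 1 : ℕ) : ℝ) ^ 2 ≤ (((Nat.sqrt n + 1 : ℕ) : ℝ) ^ 2) ^ 2 := by gcongr
      _ = _ := by ring
  rw [mul_one_div, div_div, le_div_iff₀ (by positivity)]
  calc r ^ Nat.sqrt n * (r * ((n + 1 : ℕ) : ℝ) ^ 2)
      ≤ r ^ Nat.sqrt n * (r * ((Nat.sqrt n + 1 : ℕ) : ℝ) ^ 4) := by gcongr
    _ = ((Nat.sqrt n + 1 : ℕ) : ℝ) ^ 4 * r ^ (Nat.sqrt n + 1) := by ring
    _ ≤ B := hB' _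

lemma ae_eventually_notMem_longRun {ϖ : Measure ℝ} {C₁ : ℝ} [IsProbabilityMeasure ϖ]
    (hϖc : ∀ x : ℝ, ϖ {x} = 0) (hC₁0 : 0 < C₁) (hC₁1 : C₁ < 1)
    (hdbl : ∀ (n : ℕ), ∀ J ∈ Fnfam n, ∀ I ∈ Fnfam (n + 1), I ⊆ J →
      ϖ I ≤ ENNReal.ofReal C₁ * ϖ J) :
    ∀ᵐ x ∂ϖ, ∀ᶠ n in atTop, x ∉ longRun n := by
  apply ae_eventually_notMem
  refine ne_top_of_le_ne_top ?_ (ENNReal.tsum_le_tsum (measure_longRun_le hϖc hdbl))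
  simp_rw [← ENNReal.ofReal_pow hC₁0.le]
  rw [ENNReal.tsum_mul_left]
  exact ENNReal.mul_ne_top (by simp) (summable_pow_sqrt hC₁0.le hC₁1).tsum_ofReal_ne_top

lemma exists_dyadIdx_eq {x : ℝ} (hx : x ∈ Ioc (0 : ℝ) 1) (n : ℕ) :
    ∃ j : ℕ, j < 2 ^ n ∧ dyadIdx n x = j ∧ x ∈ dyadicIcc n j := by
  have h2 : (0 : ℝ) < 2 ^ n := by positivity
  have hpos : 0 < ⌈x * 2 ^ n⌉ := Int.ceil_pos.2 (mul_pos hx.1 h2)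
  have hle : ⌈x * 2 ^ n⌉ ≤ 2 ^ n :=
    Int.ceil_le.2 (by push_cast; exact mul_le_of_le_one_left h2.le hx.2)
  obtain ⟨j, hj⟩ := Int.eq_ofNat_of_zero_le (by omega : 0 ≤ ⌈x * 2 ^ n⌉ - 1)
  have hc : ⌈x * 2 ^ n⌉ = (j : ℤ) + 1 := by omega
  have hcr : (⌈x * 2 ^ n⌉ : ℝ) = (j : ℝ) + 1 := by exact_mod_cast congrArg (Int.cast (R := ℝ)) hc
  refine ⟨j, ?_, hj, ?_⟩
  · rw [hc] at hle
    exact_mod_cast hle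
  · rw [dyadicIcc, mem_Icc, div_le_iff₀ h2, le_div_iff₀ h2, ← hcr]
    have := Int.ceil_lt_add_one (x * 2 ^ n)
    exact ⟨by linarith, Int.le_ceil _⟩

lemma mod_ne_of_notMem_longRun {x : ℝ} {n j : ℕ} (hj : j < 2 ^ n) (hxj : x ∈ dyadicIcc n j)
    (hx : x ∉ longRun n) :
    j % 2 ^ Nat.sqrt n ≠ 0 ∧ j % 2 ^ Nat.sqrt n ≠ 2 ^ Nat.sqrt n - 1 := by
  set k := Nat.sqrt n with hk
  have hkn : k ≤ n := Nat.sqrt_le_self n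
  have hi : j / 2 ^ k ∈ Finset.range (2 ^ (n - k)) := by
    rw [Finset.mem_range, Nat.div_lt_iff_lt_mul (by positivity), ← pow_add,
      Nat.sub_add_cancel hkn]
    exact hj
  have hdm := Nat.div_add_mod j (2 ^ k)
  simp only [longRun, ← hk, mem_iUnion, not_exists] at hx
  refine ⟨fun h => hx _ hi (Or.inl ?_), fun h => hx _ hi (Or.inr ?_)⟩
  · rw [h, add_zero] at hdm
    rwa [hdm]
  · rw [h] at hdm
    rwa [hdm]

lemma exists_letterWeight_bounds (T : ℕ → ℕ) {a b : ℕ → ℝ} (ha : ∀ i, i < 2 → 0 < a i ∧ a i < 1)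
    (hb : ∀ j, j < 2 → 0 < b j ∧ b j < 1) :
    ∃ m r : ℝ, 0 < m ∧ r < 1 ∧
      ∀ n e, e < 2 → m ≤ letterWeight T a b n e ∧ letterWeight T a b n e ≤ r := by
  obtain ⟨ha0, ha0'⟩ := ha 0 two_pos
  obtain ⟨ha1, ha1'⟩ := ha 1 one_lt_two
  obtain ⟨hb0, hb0'⟩ := hb 0 two_pos
  obtain ⟨hb1, hb1'⟩ := hb 1 one_lt_two
  refine ⟨min (min (a 0) (a 1)) (min (b 0) (b 1)), max (max (a 0) (a 1)) (max (b 0) (b 1)),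
    by simp [*], by simp [*], fun n e he => ?_⟩
  rw [letterWeight]
  interval_cases e <;> split_ifs <;> simp

/-- the key weak-doubling lemma, `c₁ = c₂ = 2`. -/
theorem stmt3 (T : ℕ → ℕ) (hT1 : T 1 = 1) (hTmono : ∀ k, 1 ≤ k → T k < T (k + 1))
    (hTrat : Tendsto (fun k => (T (k + 1) : ℝ) / (T k : ℝ)) atTop atTop)
    (a b : ℕ → ℝ) (ha : ∀ i, i < 2 → 0 < a i ∧ a i < 1)
    (hb : ∀ j, j < 2 → 0 < b j ∧ b j < 1)
    (hsa : ∑ i ∈ Finset.range 2, a i = 1) (hsb : ∑ j ∈ Finset.range 2, b j = 1)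
    (μ : Measure (Omg 2 2 T)) [IsProbabilityMeasure μ]
    (hμ : ∀ (n : ℕ) (w : Word 2 2 T n),
      μ (cyl 2 2 T n w) = ENNReal.ofReal (cylWeight 2 2 T a b n w))
    (ϖ : Measure ℝ) [IsProbabilityMeasure ϖ]
    (hϖc : ∀ x : ℝ, ϖ {x} = 0) (hϖs : ϖ (Set.Icc (0 : ℝ) 1) = 1)
    (C₁ : ℝ) (hC₁0 : 0 < C₁) (hC₁1 : C₁ < 1)
    (hdbl : ∀ (n : ℕ), ∀ J ∈ Fnfam n, ∀ I ∈ Fnfam (n + 1), I ⊆ J →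
      ϖ I ≤ ENNReal.ofReal C₁ * ϖ J) :
    ∃ C₀ : ℝ, 1 < C₀ ∧ ∀ᵐ x ∂ϖ, ∀ᶠ n : ℕ in atTop,
      (μ.map (gammaMap 2 2 T) (Idyad n x) ≤
          ENNReal.ofReal (C₀ ^ (Real.sqrt n + 1)) * μ.map (gammaMap 2 2 T) (IdyadP n x) ∧
        μ.map (gammaMap 2 2 T) (IdyadP n x) ≤
          ENNReal.ofReal (C₀ ^ (Real.sqrt n + 1)) * μ.map (gammaMap 2 2 T) (Idyad n x)) ∧
      (μ.map (gammaMap 2 2 T) (Idyad n x) ≤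
          ENNReal.ofReal (C₀ ^ (Real.sqrt n + 1)) * μ.map (gammaMap 2 2 T) (IdyadM n x) ∧
        μ.map (gammaMap 2 2 T) (IdyadM n x) ≤
          ENNReal.ofReal (C₀ ^ (Real.sqrt n + 1)) * μ.map (gammaMap 2 2 T) (Idyad n x)) := by
  obtain ⟨m, r, hm, hr1, hmr⟩ := exists_letterWeight_bounds T ha hb
  have hp : ∀ n e, e < 2 → 0 ≤ letterWeight T a b n e := fun n e he =>
    hm.le.trans (hmr n e he).1
  have hK : 1 < m⁻¹ := (one_lt_inv₀ hm).2
    (((hmr 0 0 two_pos).1.trans (hmr 0 0 two_pos).2).trans_lt hr1)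
  have hpK : ∀ n e e', e < 2 → e' < 2 → letterWeight T a b n e ≤ m⁻¹ * letterWeight T a b n e' := by
    intro n e e' he he'
    calc letterWeight T a b n e ≤ 1 := (hmr n e he).2.trans hr1.le
      _ = m⁻¹ * m := (inv_mul_cancel₀ hm.ne').symm
      _ ≤ _ := mul_le_mul_of_nonneg_left (hmr n e' he').1 (inv_nonneg.2 hm.le)
  refine ⟨m⁻¹, hK, ?_⟩
  have h01 : ∀ᵐ x ∂ϖ, x ∈ Ioc (0 : ℝ) 1 := by
    have h1 : ∀ᵐ x ∂ϖ, x ∈ Icc (0 : ℝ) 1 := (mem_ae_iff_prob_eq_one measurableSet_Icc).2 hϖs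
    have h2 : ∀ᵐ x ∂ϖ, x ≠ 0 := by simpa [ae_iff] using hϖc 0
    filter_upwards [h1, h2] with x hx hx0
    exact ⟨lt_of_le_of_ne hx.1 hx0.symm, hx.2⟩
  filter_upwards [h01, ae_eventually_notMem_longRun hϖc hC₁0 hC₁1 hdbl] with x hx hxr
  filter_upwards [hxr] with n hn
  obtain ⟨j, hj, hidx, hxj⟩ := exists_dyadIdx_eq hx n
  obtain ⟨hmod0, hmod1⟩ := mod_ne_of_notMem_longRun hj hxj hn
  set k := Nat.sqrt n
  have hdvd : 2 ^ k ∣ 2 ^ n := pow_dvd_pow 2 (Nat.sqrt_le_self n)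
  have hpos : 0 < 2 ^ k := by positivity
  have hj1 : j + 1 < 2 ^ n := by
    refine lt_of_le_of_ne hj fun h => hmod1 ?_
    obtain ⟨c, hc⟩ := hdvd
    cases c with
    | zero => simp at hc
    | succ c =>
      have : j = (2 ^ k - 1) + 2 ^ k * c := by
        rw [mul_add] at hc
        omega
      rw [this, Nat.add_mul_mod_self_left, Nat.mod_eq_of_lt (by omega)]
  obtain ⟨i, rfl⟩ : ∃ i, j = i + 1 := Nat.exists_eq_succ_of_ne_zero fun h => hmod0 (by simp [h])
  have hmodi : i % 2 ^ k ≠ 2 ^ k - 1 := by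
    intro h
    apply hmod0
    rw [Nat.add_mod, h]
    rcases Nat.eq_or_lt_of_le hpos with h1 | h1
    · rw [← h1]
    · rw [Nat.mod_eq_of_lt (show 1 < 2 ^ k from h1), Nat.sub_add_cancel hpos, Nat.mod_self]
  have hI : Idyad n x = dyadicIcc n (i + 1) := by
    simp [Idyad, dyadicIcc, hidx]
  have hIP : IdyadP n x = dyadicIcc n (i + 1 + 1) := by
    simp only [IdyadP, dyadicIcc, hidx]
    push_cast
    ring_nf
  have hIM : IdyadM n x = dyadicIcc n i := by
    simp [IdyadM, dyadicIcc, hidx]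
  have hpow : m⁻¹ ^ k ≤ m⁻¹ ^ (Real.sqrt n + 1) := by
    rw [← Real.rpow_natCast]
    refine Real.rpow_le_rpow_of_exponent_le hK.le ?_
    linarith [Real.nat_sqrt_le_real_sqrt (a := n)]
  have hbound : ∀ {u v : ℝ}, 0 ≤ v → u ≤ m⁻¹ ^ k * v →
      ENNReal.ofReal u ≤ ENNReal.ofReal (m⁻¹ ^ (Real.sqrt n + 1)) * ENNReal.ofReal v := by
    intro u v hv h
    rw [← ENNReal.ofReal_mul (by positivity)]
    exact ENNReal.ofReal_le_ofReal (h.trans (by gcongr))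
  have hmap : ∀ {l}, l < 2 ^ n → _ := fun hl =>
    map_gammaMap_dyadicIcc hμ hp hr1 (fun n e he => (hmr n e he).2) hl
  have hw := dyadicWeight_nonneg hp n
  rw [hI, hIP, hIM, hmap hj, hmap hj1, hmap (by omega : i < 2 ^ n)]
  obtain ⟨h1, h2⟩ := dyadicWeight_succ_comparable hK.le hp hpK k n (i + 1) hmod1
  obtain ⟨h3, h4⟩ := dyadicWeight_succ_comparable hK.le hp hpK k n i hmodi
  exact ⟨⟨hbound (hw _) h1, hbound (hw _) h2⟩, ⟨hbound (hw _) h4, hbound (hw _) h3⟩⟩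

end MF
end
end
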